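/- Let G = (V, E) be a cubic simple graph with n = |V| and let H = f(G). If M is a control matching of H containing no pair of mutually reverse arcs whose weight attains the maximum OPT(H) over all such control matchings, then |V_3(M)| = α(G); that is, the set of vertices of G all three of whose associated edge-arcs lie in M is a maximum independent set of G. -/

import Mathlib

/-! Construction `H = f(G)` from the APX-hardness reduction.  `G` is a cubic simple
graph on `V` with a fixed ordering `nbr u 0, nbr u 1, nbr u 2` of the neighbors of each
vertex `u`.  The vertices of `H` are the tokens `t_{uv}`, encoded as ordered pairs
`(u, v) : V × V` (only pairs with `G.Adj u v` occur in arcs).  An arc of `H` is an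
ordered pair of such tokens. -/

/-- An arc of `H`: an ordered pair of tokens `t_{uv}`. -/
abbrev Arc (V : Type*) := (V × V) × (V × V)

/-- The edge-arc `(t_{uv}, t_{vu})` associated with `u`, for the edge `{u, v}`. -/
def edgeArc {V : Type*} (u v : V) : Arc V := ((u, v), (v, u))

/-- The first node-arc `(t_{u v1}, t_{v2 u})` associated with `u`. -/
def nodeArc1 {V : Type*} (nbr : V → Fin 3 → V) (u : V) : Arc V :=
  ((u, nbr u 0), (nbr u 1, u))

/-- The second node-arc `(t_{u v2}, t_{v3 u})` associated with `u`. -/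
def nodeArc2 {V : Type*} (nbr : V → Fin 3 → V) (u : V) : Arc V :=
  ((u, nbr u 1), (nbr u 2, u))

/-- `a` is an edge-arc of `H`, i.e. `a = (t_{uv}, t_{vu})` for some edge `{u, v}` of `G`. -/
def IsEdgeArc {V : Type*} (G : SimpleGraph V) (a : Arc V) : Prop :=
  G.Adj a.1.1 a.1.2 ∧ a.2 = (a.1.2, a.1.1)

/-- `a` is a node-arc of `H`. -/
def IsNodeArc {V : Type*} (nbr : V → Fin 3 → V) (a : Arc V) : Prop :=
  ∃ u, a = nodeArc1 nbr u ∨ a = nodeArc2 nbr u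

/-- `a` is an arc of `H = f(G)`: an edge-arc (weight 1), a node-arc (weight 1), or the
reverse of a node-arc (weight 0). -/
def IsArcH {V : Type*} (G : SimpleGraph V) (nbr : V → Fin 3 → V) (a : Arc V) : Prop :=
  IsEdgeArc G a ∨ IsNodeArc nbr a ∨ IsNodeArc nbr (Prod.swap a)

/-- A control matching of `H`: a set of arcs of `H` such that each vertex of `H` is the
head of at most one arc in `M` and the tail of at most one arc in `M`. -/
def IsControlMatching {V : Type*} (G : SimpleGraph V) (nbr : V → Fin 3 → V)
    (M : Finset (Arc V)) : Prop :=
  (∀ a ∈ M, IsArcH G nbr a) ∧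
  (∀ a ∈ M, ∀ b ∈ M, a.1 = b.1 → a = b) ∧
  (∀ a ∈ M, ∀ b ∈ M, a.2 = b.2 → a = b)

/-- `M` contains no pair of mutually reverse arcs. -/
def NoReversePair {V : Type*} (M : Finset (Arc V)) : Prop :=
  ∀ a ∈ M, Prod.swap a ∉ M

open scoped Classical in
/-- The weight of `M`: edge-arcs and node-arcs have weight 1, all other arcs (the
reverses of node-arcs) have weight 0, so `w(M)` is the number of edge- and node-arcs
in `M`. -/
noncomputable def weightM {V : Type*} (G : SimpleGraph V) (nbr : V → Fin 3 → V)
    (M : Finset (Arc V)) : ℕ :=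
  (M.filter (fun a => IsEdgeArc G a ∨ IsNodeArc nbr a)).card

open scoped Classical in
/-- `V₃(M)`: the set of vertices `u` of `G` all three of whose associated edge-arcs lie
in `M`. -/
noncomputable def V3 {V : Type*} [Fintype V] (nbr : V → Fin 3 → V)
    (M : Finset (Arc V)) : Finset V :=
  Finset.univ.filter (fun u => ∀ i : Fin 3, edgeArc u (nbr u i) ∈ M)

/-- The five weight-1 arcs associated with the vertex `u`: its three edge-arcs and its
two node-arcs. -/
def assocArcs {V : Type*} [DecidableEq V] (nbr : V → Fin 3 → V) (u : V) :
    Finset (Arc V) :=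
  {edgeArc u (nbr u 0), edgeArc u (nbr u 1), edgeArc u (nbr u 2),
   nodeArc1 nbr u, nodeArc2 nbr u}

/-- The independence number `α(G)`. -/
noncomputable def indepNum {V : Type*} [Fintype V] (G : SimpleGraph V) : ℕ :=
  sSup {k : ℕ | ∃ S : Finset V, (∀ a ∈ S, ∀ b ∈ S, ¬ G.Adj a b) ∧ S.card = k}

/-- `OPT(H)`: the maximum weight of a control matching of `H` containing no pair of
mutually reverse arcs. -/
noncomputable def OPT {V : Type*} (G : SimpleGraph V) (nbr : V → Fin 3 → V) : ℕ :=
  sSup {k : ℕ | ∃ M : Finset (Arc V),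
    IsControlMatching G nbr M ∧ NoReversePair M ∧ weightM G nbr M = k}

open scoped Classical in
/-- The weight-1 arcs of `M` whose tail is a token `t_{uv}` lie among the five arcs associated
with `u`. -/
theorem weight_fiber_subset {V : Type*} [DecidableEq V] {G : SimpleGraph V}
    {nbr : V → Fin 3 → V} (hadj : ∀ u v : V, G.Adj u v ↔ ∃ i : Fin 3, nbr u i = v)
    {M : Finset (Arc V)} {u : V} {a : Arc V}
    (ha : a ∈ (M.filter (fun a => IsEdgeArc G a ∨ IsNodeArc nbr a)).filter (fun a => a.1.1 = u)) :
    a ∈ M ∧ (a = edgeArc u (nbr u 0) ∨ a = edgeArc u (nbr u 1) ∨ a = edgeArc u (nbr u 2) ∨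
      a = nodeArc1 nbr u ∨ a = nodeArc2 nbr u) := by
  simp only [Finset.mem_filter] at ha
  obtain ⟨⟨haM, ha⟩, rfl⟩ := ha
  refine ⟨haM, ?_⟩
  rcases ha with ⟨h1, h2⟩ | ⟨w, rfl | rfl⟩
  · obtain ⟨i, hi⟩ := (hadj _ _).1 h1
    have key : a = edgeArc a.1.1 (nbr a.1.1 i) := by
      rw [hi]
      exact Prod.ext rfl h2
    fin_cases i
    · exact Or.inl key
    · exact Or.inr (Or.inl key)
    · exact Or.inr (Or.inr (Or.inl key))
  · simp [nodeArc1]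
  · simp [nodeArc2]

open scoped Classical in
/-- A control matching contains at most two weight-1 arcs associated with `u`, or three if
`u ∈ V₃(M)`. -/
theorem card_weight_fiber_le {V : Type*} [Fintype V] [DecidableEq V] {G : SimpleGraph V}
    {nbr : V → Fin 3 → V} (hadj : ∀ u v : V, G.Adj u v ↔ ∃ i : Fin 3, nbr u i = v)
    (hinj : ∀ u : V, Function.Injective (nbr u))
    {M : Finset (Arc V)} (hM : IsControlMatching G nbr M) (u : V) :
    ((M.filter (fun a => IsEdgeArc G a ∨ IsNodeArc nbr a)).filter (fun a => a.1.1 = u)).card ≤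
      2 + if u ∈ V3 nbr M then 1 else 0 := by
  have h01 : nbr u 0 ≠ nbr u 1 := (hinj u).ne (by decide)
  have h12 : nbr u 1 ≠ nbr u 2 := (hinj u).ne (by decide)
  have c1 : edgeArc u (nbr u 0) ∈ M → nodeArc1 nbr u ∉ M := fun h h' =>
    h01 (by simpa [edgeArc, nodeArc1] using hM.2.1 _ h _ h' rfl)
  have c2 : edgeArc u (nbr u 1) ∈ M → nodeArc1 nbr u ∉ M := fun h h' =>
    h01 (by simpa [edgeArc, nodeArc1, eq_comm] using hM.2.2 _ h _ h' rfl)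
  have c3 : edgeArc u (nbr u 1) ∈ M → nodeArc2 nbr u ∉ M := fun h h' =>
    h12 (by simpa [edgeArc, nodeArc2] using hM.2.1 _ h _ h' rfl)
  have c4 : edgeArc u (nbr u 2) ∈ M → nodeArc2 nbr u ∉ M := fun h h' =>
    h12 (by simpa [edgeArc, nodeArc2, eq_comm] using hM.2.2 _ h _ h' rfl)
  have sub := fun a => @weight_fiber_subset V _ G nbr hadj M u a
  have hV : u ∈ V3 nbr M ↔ edgeArc u (nbr u 0) ∈ M ∧ edgeArc u (nbr u 1) ∈ M ∧
      edgeArc u (nbr u 2) ∈ M := by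
    simp [V3, Fin.forall_fin_succ]
  generalize (M.filter (fun a => IsEdgeArc G a ∨ IsNodeArc nbr a)).filter
    (fun a => a.1.1 = u) = F at sub ⊢
  have pair : ∀ x y : Arc V, (∀ a ∈ F, a = x ∨ a = y) →
      F.card ≤ 2 + if u ∈ V3 nbr M then 1 else 0 := fun x y h =>
    (Finset.card_le_card (t := {x, y}) fun a ha => by simpa using h a ha).trans
      (Finset.card_le_two.trans (Nat.le_add_right _ _))
  by_cases hn1 : nodeArc1 nbr u ∈ M
  · by_cases hn2 : nodeArc2 nbr u ∈ M
    · exact pair (nodeArc1 nbr u) (nodeArc2 nbr u) (by grind)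
    · exact pair (nodeArc1 nbr u) (edgeArc u (nbr u 2)) (by grind)
  · by_cases hn2 : nodeArc2 nbr u ∈ M
    · exact pair (edgeArc u (nbr u 0)) (nodeArc2 nbr u) (by grind)
    · by_cases h3 : u ∈ V3 nbr M
      · rw [if_pos h3]
        refine (Finset.card_le_card (t := {edgeArc u (nbr u 0), edgeArc u (nbr u 1),
          edgeArc u (nbr u 2)}) fun a ha => ?_).trans Finset.card_le_three
        have := sub a ha
        simp only [Finset.mem_insert, Finset.mem_singleton]
        grind
      · by_cases e0 : edgeArc u (nbr u 0) ∈ M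
        · by_cases e1 : edgeArc u (nbr u 1) ∈ M
          · exact pair (edgeArc u (nbr u 0)) (edgeArc u (nbr u 1)) (by grind)
          · exact pair (edgeArc u (nbr u 0)) (edgeArc u (nbr u 2)) (by grind)
        · exact pair (edgeArc u (nbr u 1)) (edgeArc u (nbr u 2)) (by grind)

/-- A control matching has weight at most `2n + |V₃(M)|`. -/
theorem weightM_le {V : Type*} [Fintype V] [DecidableEq V] {G : SimpleGraph V}
    {nbr : V → Fin 3 → V} (hadj : ∀ u v : V, G.Adj u v ↔ ∃ i : Fin 3, nbr u i = v)
    (hinj : ∀ u : V, Function.Injective (nbr u))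
    {M : Finset (Arc V)} (hM : IsControlMatching G nbr M) :
    weightM G nbr M ≤ 2 * Fintype.card V + (V3 nbr M).card := by
  classical
  rw [weightM, Finset.card_eq_sum_card_fiberwise (f := fun a : Arc V => a.1.1)
    (t := Finset.univ) (fun _ _ => Finset.mem_coe.2 (Finset.mem_univ _))]
  refine (Finset.sum_le_sum fun u _ => card_weight_fiber_le hadj hinj hM u).trans ?_
  rw [Finset.sum_add_distrib]
  simp [mul_comm]

/-- `V₃(M)` is independent when `M` contains no two mutually reverse arcs. -/
theorem V3_indep {V : Type*} [Fintype V] {G : SimpleGraph V}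
    {nbr : V → Fin 3 → V} (hadj : ∀ u v : V, G.Adj u v ↔ ∃ i : Fin 3, nbr u i = v)
    {M : Finset (Arc V)} (hrev : NoReversePair M) :
    ∀ a ∈ V3 nbr M, ∀ b ∈ V3 nbr M, ¬ G.Adj a b := by
  intro a ha b hb hab
  obtain ⟨i, hi⟩ := (hadj _ _).1 hab
  obtain ⟨j, hj⟩ := (hadj _ _).1 hab.symm
  simp only [V3, Finset.mem_filter, Finset.mem_univ, true_and] at ha hb
  have h1 := ha i
  have h2 := hb j
  rw [hi] at h1
  rw [hj] at h2
  exact hrev _ h1 h2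

/-- The arcs associated with `u` used by the matching built from an independent set `S`. -/
def indepArcs {V : Type*} [DecidableEq V] (nbr : V → Fin 3 → V) (S : Finset V) (u : V) :
    Finset (Arc V) :=
  if u ∈ S then {edgeArc u (nbr u 0), edgeArc u (nbr u 1), edgeArc u (nbr u 2)}
  else {nodeArc1 nbr u, nodeArc2 nbr u}

theorem mem_indepArcs {V : Type*} [DecidableEq V] {nbr : V → Fin 3 → V} {S : Finset V} {u : V}
    {a : Arc V} : a ∈ indepArcs nbr S u ↔
      (u ∈ S ∧ ∃ i, a = edgeArc u (nbr u i)) ∨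
      (u ∉ S ∧ (a = nodeArc1 nbr u ∨ a = nodeArc2 nbr u)) := by
  by_cases h : u ∈ S <;> simp [indepArcs, h, Fin.exists_fin_succ]

theorem card_indepArcs {V : Type*} [DecidableEq V] {nbr : V → Fin 3 → V}
    (hinj : ∀ u : V, Function.Injective (nbr u)) (S : Finset V) (u : V) :
    (indepArcs nbr S u).card = 2 + if u ∈ S then 1 else 0 := by
  have h01 : nbr u 0 ≠ nbr u 1 := (hinj u).ne (by decide)
  have h02 : nbr u 0 ≠ nbr u 2 := (hinj u).ne (by decide)
  have h12 : nbr u 1 ≠ nbr u 2 := (hinj u).ne (by decide)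
  by_cases h : u ∈ S
  · simp only [indepArcs, h, if_true]
    exact Finset.card_eq_three.2 ⟨_, _, _, by simp [edgeArc, h01], by simp [edgeArc, h02],
      by simp [edgeArc, h12], rfl⟩
  · simp only [indepArcs, h, if_false]
    exact Finset.card_pair (by simp [nodeArc1, nodeArc2, h01])

theorem indepArcs_tail_inj {V : Type*} [DecidableEq V] {nbr : V → Fin 3 → V}
    {S : Finset V} {u : V} (h : nbr u 0 ≠ nbr u 1) {a b : Arc V}
    (ha : a ∈ indepArcs nbr S u) (hb : b ∈ indepArcs nbr S u) (hab : a.1 = b.1) : a = b := by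
  rcases mem_indepArcs.1 ha with ⟨hu, i, rfl⟩ | ⟨hu, rfl | rfl⟩ <;>
  rcases mem_indepArcs.1 hb with ⟨hu', j, rfl⟩ | ⟨hu', rfl | rfl⟩ <;>
  simp only [edgeArc, nodeArc1, nodeArc2, Prod.mk.injEq, true_and, and_true] at hab ⊢ <;>
  grind

theorem indepArcs_head_inj {V : Type*} [DecidableEq V] {nbr : V → Fin 3 → V}
    {S : Finset V} {u : V} (h : nbr u 1 ≠ nbr u 2) {a b : Arc V}
    (ha : a ∈ indepArcs nbr S u) (hb : b ∈ indepArcs nbr S u) (hab : a.2 = b.2) : a = b := by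
  rcases mem_indepArcs.1 ha with ⟨hu, i, rfl⟩ | ⟨hu, rfl | rfl⟩ <;>
  rcases mem_indepArcs.1 hb with ⟨hu', j, rfl⟩ | ⟨hu', rfl | rfl⟩ <;>
  simp only [edgeArc, nodeArc1, nodeArc2, Prod.mk.injEq, true_and, and_true] at hab ⊢ <;>
  grind

/-- Every independent set `S` gives a control matching of weight `2n + |S|`. -/
theorem exists_controlMatching {V : Type*} [Fintype V] [DecidableEq V] {G : SimpleGraph V}
    {nbr : V → Fin 3 → V} (hadj : ∀ u v : V, G.Adj u v ↔ ∃ i : Fin 3, nbr u i = v)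
    (hinj : ∀ u : V, Function.Injective (nbr u))
    {S : Finset V} (hS : ∀ a ∈ S, ∀ b ∈ S, ¬ G.Adj a b) :
    ∃ M : Finset (Arc V), IsControlMatching G nbr M ∧ NoReversePair M ∧
      weightM G nbr M = 2 * Fintype.card V + S.card := by
  have h01 : ∀ u, nbr u 0 ≠ nbr u 1 := fun u => (hinj u).ne (by decide)
  have h12 : ∀ u, nbr u 1 ≠ nbr u 2 := fun u => (hinj u).ne (by decide)
  have tail : ∀ {u a}, a ∈ indepArcs nbr S u → a.1.1 = u := by
    intro u a ha
    rcases mem_indepArcs.1 ha with ⟨_, i, rfl⟩ | ⟨_, rfl | rfl⟩ <;> rfl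
  have head : ∀ {u a}, a ∈ indepArcs nbr S u → a.2.2 = u := by
    intro u a ha
    rcases mem_indepArcs.1 ha with ⟨_, i, rfl⟩ | ⟨_, rfl | rfl⟩ <;> rfl
  have weight : ∀ {u a}, a ∈ indepArcs nbr S u → IsEdgeArc G a ∨ IsNodeArc nbr a := by
    intro u a ha
    rcases mem_indepArcs.1 ha with ⟨_, i, rfl⟩ | ⟨_, h⟩
    · exact Or.inl ⟨(hadj _ _).2 ⟨i, rfl⟩, rfl⟩
    · exact Or.inr ⟨u, h⟩
  refine ⟨Finset.univ.biUnion (indepArcs nbr S), ⟨?_, ?_, ?_⟩, ?_, ?_⟩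
  · intro a ha
    obtain ⟨u, -, hu⟩ := Finset.mem_biUnion.1 ha
    exact (weight hu).imp_right Or.inl
  · intro a ha b hb hab
    obtain ⟨u, -, hu⟩ := Finset.mem_biUnion.1 ha
    obtain ⟨v, -, hv⟩ := Finset.mem_biUnion.1 hb
    obtain rfl : u = v := by rw [← tail hu, ← tail hv, hab]
    exact indepArcs_tail_inj (h01 u) hu hv hab
  · intro a ha b hb hab
    obtain ⟨u, -, hu⟩ := Finset.mem_biUnion.1 ha
    obtain ⟨v, -, hv⟩ := Finset.mem_biUnion.1 hb
    obtain rfl : u = v := by rw [← head hu, ← head hv, hab]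
    exact indepArcs_head_inj (h12 u) hu hv hab
  · intro a ha hb
    obtain ⟨u, -, hu⟩ := Finset.mem_biUnion.1 ha
    obtain ⟨v, -, hv⟩ := Finset.mem_biUnion.1 hb
    have e : a.1.2 = a.2.1 := (head hv).trans (tail hv).symm
    rcases mem_indepArcs.1 hu with ⟨h, i, rfl⟩ | ⟨h, rfl | rfl⟩
    · obtain rfl : nbr u i = v := tail hv
      rcases mem_indepArcs.1 hv with ⟨h', -⟩ | ⟨h', h''⟩
      · exact hS _ h _ h' ((hadj _ _).2 ⟨i, rfl⟩)
      · have := h01 (nbr u i)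
        have := h12 (nbr u i)
        rcases h'' with h'' | h'' <;> simp [edgeArc, nodeArc1, nodeArc2] at h'' <;> grind
    · exact h01 u e
    · exact h12 u e
  · classical
    rw [weightM, Finset.filter_true_of_mem, Finset.card_biUnion]
    · simp only [card_indepArcs hinj]
      rw [Finset.sum_add_distrib]
      simp [mul_comm]
    · intro u _ v _ huv
      exact Finset.disjoint_left.2 fun a ha hb => huv ((tail ha).symm.trans (tail hb))
    · intro a ha
      obtain ⟨u, -, hu⟩ := Finset.mem_biUnion.1 ha
      exact weight hu

/-- If `M` is a control matching of `H = f(G)` with no pair of mutually reverse arcs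
whose weight attains `OPT(H)`, then `V₃(M)` is a maximum independent set of `G`:
it is independent and `|V₃(M)| = α(G)`. -/
theorem stmt17 {V : Type*} [Fintype V] [DecidableEq V] (G : SimpleGraph V)
    (nbr : V → Fin 3 → V)
    (hadj : ∀ u v : V, G.Adj u v ↔ ∃ i : Fin 3, nbr u i = v)
    (hinj : ∀ u : V, Function.Injective (nbr u))
    (M : Finset (Arc V)) (hM : IsControlMatching G nbr M) (hrev : NoReversePair M)
    (hopt : weightM G nbr M = OPT G nbr) :
    (∀ a ∈ V3 nbr M, ∀ b ∈ V3 nbr M, ¬ G.Adj a b) ∧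
      (V3 nbr M).card = indepNum G := by
  have hind := V3_indep hadj hrev
  refine ⟨hind, ?_⟩
  have bddα : BddAbove {k : ℕ | ∃ S : Finset V,
      (∀ a ∈ S, ∀ b ∈ S, ¬ G.Adj a b) ∧ S.card = k} :=
    ⟨Fintype.card V, by rintro _ ⟨S, -, rfl⟩; exact S.card_le_univ⟩
  refine le_antisymm (le_csSup bddα ⟨_, hind, rfl⟩) ?_
  obtain ⟨S, hS, hcard⟩ : ∃ S : Finset V,
      (∀ a ∈ S, ∀ b ∈ S, ¬ G.Adj a b) ∧ S.card = indepNum G :=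
    Nat.sSup_mem (s := {k : ℕ | ∃ S : Finset V, (∀ a ∈ S, ∀ b ∈ S, ¬ G.Adj a b) ∧ S.card = k})
      ⟨_, V3 nbr M, hind, rfl⟩ bddα
  obtain ⟨N, hN, hNrev, hNw⟩ := exists_controlMatching hadj hinj hS
  have bddOpt : BddAbove {k : ℕ | ∃ M : Finset (Arc V),
      IsControlMatching G nbr M ∧ NoReversePair M ∧ weightM G nbr M = k} := by
    refine ⟨2 * Fintype.card V + Fintype.card V, ?_⟩
    rintro _ ⟨M', hM', -, rfl⟩
    exact (weightM_le hadj hinj hM').trans (Nat.add_le_add_left (Finset.card_le_univ _) _)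
  have hle : weightM G nbr N ≤ OPT G nbr := le_csSup bddOpt ⟨N, hN, hNrev, rfl⟩
  have hup := weightM_le hadj hinj hM
  omega
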